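/- Let X = (ℝ/ℤ)³ with its quotient metric, let μ be a Borel probability measure on X, and let T : X → X be a μ-preserving Borel bijection. Let (m_n) be natural numbers and (T_n) μ-preserving Borel bijections of X with sup_{x∈X} dist(T_n^{m_n}(x), T^{m_n}(x)) < 1/2ⁿ for every n. Let (ν_n) be a sequence of partial partitions of X converging to the decomposition into points, and assume: for every cube A ⊆ X and every ε ∈ (0,1] there exists N ∈ ℕ such that for all n ≥ N and all Γ ∈ ν_n, |μ(Γ ∩ T_n^{−m_n}(A)) − μ(Γ)μ(A)| ≤ ε · μ(Γ)μ(A). Then T is weakly mixing with respect to μ: there exists a strictly increasing sequence (s_j) of natural numbers such that μ(B ∩ T^{−s_j}(A)) → μ(A)μ(B) for all Borel sets A, B ⊆ X. -/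

import Mathlib

noncomputable section
open MeasureTheory Filter Set

/-- The 3-torus `(ℝ/ℤ)³`. -/
abbrev T3 : Type := AddCircle (1 : ℝ) × AddCircle (1 : ℝ) × AddCircle (1 : ℝ)

/-- Canonical projection `ℝ³ → (ℝ/ℤ)³`. -/
def pro3 (x : ℝ × ℝ × ℝ) : T3 :=
  ((x.1 : AddCircle (1 : ℝ)), (x.2.1 : AddCircle (1 : ℝ)), (x.2.2 : AddCircle (1 : ℝ)))

/-- The quotient (Euclidean) metric on `(ℝ/ℤ)³`. -/
def d3 (x y : T3) : ℝ :=
  sInf {d : ℝ | ∃ a b : ℝ × ℝ × ℝ, pro3 a = x ∧ pro3 b = y ∧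
    d = Real.sqrt ((a.1 - b.1) ^ 2 + (a.2.1 - b.2.1) ^ 2 + (a.2.2 - b.2.2) ^ 2)}

/-- A cube in `(ℝ/ℤ)³`: the image under the quotient map of a product of three closed
intervals, each of length at most `1`. -/
def IsCube3 (A : Set T3) : Prop :=
  ∃ a₁ b₁ a₂ b₂ a₃ b₃ : ℝ, a₁ ≤ b₁ ∧ b₁ - a₁ ≤ 1 ∧ a₂ ≤ b₂ ∧ b₂ - a₂ ≤ 1 ∧
    a₃ ≤ b₃ ∧ b₃ - a₃ ≤ 1 ∧
    A = pro3 '' (Icc a₁ b₁ ×ˢ Icc a₂ b₂ ×ˢ Icc a₃ b₃)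

/-- A partial partition: a countable collection of pairwise disjoint Borel sets. -/
def PartialPartition (P : Set (Set T3)) : Prop :=
  P.Countable ∧ (∀ s ∈ P, MeasurableSet s) ∧ P.PairwiseDisjoint id

/-- A sequence of partial partitions converges to the decomposition into points if
every Borel set is approximated in measure by unions of partition elements. -/
def ConvToPoints (μ : Measure T3) (ν : ℕ → Set (Set T3)) : Prop :=
  ∀ A : Set T3, MeasurableSet A → ∃ B : ℕ → Set T3,
    (∀ n, ∃ S ⊆ ν n, B n = ⋃₀ S) ∧
    Tendsto (fun n => μ (symmDiff A (B n))) atTop (nhds 0)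

lemma hasSum_real_iUnion' {ι : Type*} [Countable ι] (μ : Measure T3) [IsProbabilityMeasure μ]
    (f : ι → Set T3) (hd : Pairwise (Function.onFun Disjoint f)) (hm : ∀ i, MeasurableSet (f i)) :
    HasSum (fun i => μ.real (f i)) (μ.real (⋃ i, f i)) := by
  have h := measure_iUnion (μ := μ) hd hm
  have hne : ∑' i, μ (f i) ≠ ⊤ := by rw [← h]; exact measure_ne_top _ _
  have := ENNReal.hasSum_toReal hne
  simp only [Measure.real]
  rw [h, ENNReal.tsum_toReal_eq (fun i => measure_ne_top _ _)]
  exact this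

/-- the mixing property along a sequence, for a fixed target set -/
def MixOn (μ : Measure T3) (R : ℕ → T3 → T3) (A : Set T3) : Prop :=
  ∀ B : Set T3, MeasurableSet B →
    Tendsto (fun n => μ.real (B ∩ (R n) ⁻¹' A)) atTop (nhds (μ.real A * μ.real B))

lemma mixOn_of_pi (μ : Measure T3) [IsProbabilityMeasure μ] (R : ℕ → T3 → T3)
    (hR : ∀ n, MeasurePreserving (R n) μ μ) (C : Set (Set T3))
    (hgen : (inferInstance : MeasurableSpace T3) = MeasurableSpace.generateFrom C)
    (hpi : IsPiSystem C) (hC : ∀ A ∈ C, MixOn μ R A) :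
    ∀ A, MeasurableSet A → MixOn μ R A := by
  refine MeasurableSpace.induction_on_inter (C := fun A _ => MixOn μ R A) hgen hpi ?_ hC ?_ ?_
  · intro B hB
    simp
  · intro A hA h B hB
    have h1 := (h B hB).const_sub (μ.real B)
    have e : μ.real Aᶜ * μ.real B = μ.real B - μ.real A * μ.real B := by
      rw [probReal_compl_eq_one_sub hA]; ring
    rw [e]
    refine h1.congr fun n => ?_
    have := measureReal_inter_add_sdiff (μ := μ) (s := B) ((hR n).measurable hA)
    rw [preimage_compl, ← sdiff_eq]
    linarith
  · intro f hd hm h B hB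
    have hs := hasSum_real_iUnion' μ f hd hm
    have e : μ.real (⋃ i, f i) * μ.real B = ∑' i, μ.real (f i) * μ.real B :=
      (hs.mul_right _).tsum_eq.symm
    rw [e]
    have key := tendsto_tsum_of_dominated_convergence (𝓕 := atTop)
      (f := fun n i => μ.real (B ∩ (R n) ⁻¹' (f i))) (g := fun i => μ.real (f i) * μ.real B)
      hs.summable (fun i => h i B hB) (Eventually.of_forall fun n i => by
        rw [Real.norm_of_nonneg measureReal_nonneg, ← (hR n).measureReal_preimage (hm i).nullMeasurableSet]
        exact measureReal_mono inter_subset_right)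
    refine key.congr fun n => ?_
    have := hasSum_real_iUnion' μ (fun i => B ∩ (R n) ⁻¹' (f i))
      (fun i j hij => ((hd hij).preimage (R n)).mono inter_subset_right inter_subset_right)
      (fun i => hB.inter ((hR n).measurable (hm i)))
    rw [this.tsum_eq, preimage_iUnion, inter_iUnion]

/-- the coordinate function -/
def fc : AddCircle (1 : ℝ) → ℝ := fun x => (AddCircle.measurableEquivIco (1 : ℝ) 0 x : ℝ)

lemma fc_emb : MeasurableEmbedding fc :=
  (MeasurableEmbedding.subtype_coe measurableSet_Ico).comp
    (AddCircle.measurableEquivIco (1 : ℝ) 0).measurableEmbedding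

lemma fc_mem (x : AddCircle (1 : ℝ)) : 0 ≤ fc x ∧ fc x < 1 := by
  have := (AddCircle.measurableEquivIco (1 : ℝ) 0 x).2
  simpa [fc] using this

lemma coe_fc (x : AddCircle (1 : ℝ)) : ((fc x : ℝ) : AddCircle (1 : ℝ)) = x :=
  AddCircle.coe_equivIco (p := (1 : ℝ)) (a := 0)

lemma fc_coe (y : ℝ) (h0 : 0 ≤ y) (h1 : y < 1) : fc (y : AddCircle (1 : ℝ)) = y :=
  AddCircle.equivIco_coe_of_mem (p := (1 : ℝ)) (a := 0) (by simp [h0, h1])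

/-- generating arcs -/
def arcs : Set (Set (AddCircle (1 : ℝ))) := preimage fc '' range Iic

lemma arcs_gen : (inferInstance : MeasurableSpace (AddCircle (1 : ℝ)))
    = MeasurableSpace.generateFrom arcs := by
  rw [arcs, ← MeasurableSpace.comap_generateFrom, ← borel_eq_generateFrom_Iic ℝ,
    ← BorelSpace.measurable_eq (α := ℝ)]
  exact fc_emb.comap_eq.symm

lemma arcs_pi : IsPiSystem arcs := isPiSystem_Iic.comap fc

lemma univ_mem_arcs : univ ∈ arcs := by
  refine ⟨Iic 1, ⟨1, rfl⟩, ?_⟩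
  ext x
  simp [(fc_mem x).2.le]

lemma arcs_span : IsCountablySpanning arcs :=
  ⟨fun _ => univ, fun _ => univ_mem_arcs, iUnion_const _⟩

lemma arcs_cases (s) (hs : s ∈ arcs) : s = ∅ ∨ ∃ b : ℝ, 0 ≤ b ∧ b ≤ 1 ∧
    s = (fun y : ℝ => (y : AddCircle (1 : ℝ))) '' Icc 0 b := by
  obtain ⟨_, ⟨b, rfl⟩, rfl⟩ := hs
  rcases lt_or_ge b 0 with hb | hb
  · left
    ext x
    have := (fc_mem x).1
    simp only [mem_preimage, mem_Iic, mem_empty_iff_false, iff_false, not_le]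
    linarith
  · right
    rcases lt_or_ge b 1 with hb1 | hb1
    · refine ⟨b, hb, hb1.le, ?_⟩
      ext x
      constructor
      · intro hx
        exact ⟨fc x, ⟨(fc_mem x).1, hx⟩, coe_fc x⟩
      · rintro ⟨y, hy, rfl⟩
        simp only [mem_preimage, mem_Iic]
        rw [fc_coe y hy.1 (hy.2.trans_lt hb1)]
        exact hy.2
    · refine ⟨1, zero_le_one, le_rfl, ?_⟩
      ext x
      constructor
      · intro hx
        exact ⟨fc x, ⟨(fc_mem x).1, (fc_mem x).2.le⟩, coe_fc x⟩
      · intro _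
        simp only [mem_preimage, mem_Iic]
        linarith [(fc_mem x).2]

/-- generating boxes -/
def boxes : Set (Set T3) := image2 (· ×ˢ ·) arcs (image2 (· ×ˢ ·) arcs arcs)

lemma boxes_pi : IsPiSystem boxes := arcs_pi.prod (arcs_pi.prod arcs_pi)

lemma gen2 : (inferInstance : MeasurableSpace (AddCircle (1 : ℝ) × AddCircle (1 : ℝ)))
    = MeasurableSpace.generateFrom (image2 (· ×ˢ ·) arcs arcs) :=
  (generateFrom_eq_prod arcs_gen.symm arcs_gen.symm arcs_span arcs_span).symm

lemma boxes_gen : (inferInstance : MeasurableSpace T3) = MeasurableSpace.generateFrom boxes :=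
  (generateFrom_eq_prod arcs_gen.symm gen2.symm arcs_span (arcs_span.prod arcs_span)).symm

lemma boxes_cases (s) (hs : s ∈ boxes) : s = ∅ ∨ IsCube3 s := by
  obtain ⟨s1, h1, _, ⟨s2, h2, s3, h3, rfl⟩, rfl⟩ := hs
  rcases arcs_cases s1 h1 with rfl | ⟨b1, hb1, hb1', rfl⟩
  · left; simp
  rcases arcs_cases s2 h2 with rfl | ⟨b2, hb2, hb2', rfl⟩
  · left; simp
  rcases arcs_cases s3 h3 with rfl | ⟨b3, hb3, hb3', rfl⟩
  · left; simp
  right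
  refine ⟨0, b1, 0, b2, 0, b3, hb1, by simpa, hb2, by simpa, hb3, by simpa, ?_⟩
  ext ⟨x, y, z⟩
  constructor
  · rintro ⟨⟨a, ha, hx⟩, ⟨b, hb, hy⟩, ⟨c, hc, hz⟩⟩
    exact ⟨(a, b, c), ⟨ha, hb, hc⟩, Prod.ext hx (Prod.ext hy hz)⟩
  · rintro ⟨⟨a, b, c⟩, ⟨ha, hb, hc⟩, h⟩
    simp only [pro3, Prod.mk.injEq] at h
    exact ⟨⟨a, ha, h.1⟩, ⟨b, hb, h.2.1⟩, ⟨c, hc, h.2.2⟩⟩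

lemma boxes_meas (s) (hs : s ∈ boxes) : MeasurableSet s := by
  have h : @MeasurableSet T3 (MeasurableSpace.generateFrom boxes) s :=
    MeasurableSpace.measurableSet_generateFrom hs
  rw [← boxes_gen] at h
  exact h

lemma sUnion_est (μ : Measure T3) [IsProbabilityMeasure μ] (P S : Set (Set T3))
    (hP : PartialPartition P) (hS : S ⊆ P) (W : Set T3) (hW : MeasurableSet W) (a ε : ℝ)
    (h : ∀ Γ ∈ P, |μ.real (Γ ∩ W) - μ.real Γ * a| ≤ ε * μ.real Γ * a) :
    |μ.real (⋃₀ S ∩ W) - μ.real (⋃₀ S) * a| ≤ ε * μ.real (⋃₀ S) * a := by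
  obtain ⟨hc, hm, hd⟩ := hP
  have : Countable S := (hc.mono hS).to_subtype
  have hd' : Pairwise (Function.onFun Disjoint (fun i : S => (i : Set T3))) :=
    fun i j hij => hd (hS i.2) (hS j.2) (fun e => hij (Subtype.ext e))
  have s1 := hasSum_real_iUnion' μ (fun i : S => (i : Set T3)) hd' (fun i => hm _ (hS i.2))
  have s2 := hasSum_real_iUnion' μ (fun i : S => (i : Set T3) ∩ W)
    (fun i j hij => (hd' hij).mono inter_subset_left inter_subset_left)
    (fun i => (hm _ (hS i.2)).inter hW)
  rw [← iUnion_inter, ← sUnion_eq_iUnion] at s2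
  rw [← sUnion_eq_iUnion] at s1
  have s3 := s2.sub (s1.mul_right a)
  have s4 := (s1.mul_left ε).mul_right a
  rw [abs_le]
  exact ⟨hasSum_le (fun i : S => (abs_le.1 (h i (hS i.2))).1) s4.neg s3,
    hasSum_le (fun i : S => (abs_le.1 (h i (hS i.2))).2) s3 s4⟩

lemma mixOn_cube (μ : Measure T3) [IsProbabilityMeasure μ] (R : ℕ → T3 → T3)
    (hR : ∀ n, MeasurePreserving (R n) μ μ)
    (ν : ℕ → Set (Set T3)) (hν : ∀ n, PartialPartition (ν n)) (hconv : ConvToPoints μ ν)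
    (A : Set T3) (hA : MeasurableSet A)
    (hdist : ∀ ε : ℝ, ε ∈ Set.Ioc (0 : ℝ) 1 →
      ∃ N : ℕ, ∀ n ≥ N, ∀ Γ ∈ ν n,
        |μ.real (Γ ∩ (R n) ⁻¹' A) - μ.real Γ * μ.real A| ≤ ε * μ.real Γ * μ.real A) :
    MixOn μ R A := by
  intro B hB
  obtain ⟨D, hD, hlim⟩ := hconv B hB
  have hlim' : Tendsto (fun n => μ.real (symmDiff B (D n))) atTop (nhds 0) := by
    have := (ENNReal.tendsto_toReal ENNReal.zero_ne_top).comp hlim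
    rw [ENNReal.toReal_zero] at this
    exact this
  have hDm : ∀ n, MeasurableSet (D n) := by
    intro n
    obtain ⟨S, hS, e⟩ := hD n
    rw [e]
    exact MeasurableSet.sUnion ((hν n).1.mono hS) (fun t ht => (hν n).2.1 t (hS ht))
  rw [Metric.tendsto_atTop]
  intro ε hε
  obtain ⟨N1, h1⟩ := (Metric.tendsto_atTop.1 hlim') (ε / 4) (by positivity)
  have hε' : min (ε / 4) 1 ∈ Set.Ioc (0 : ℝ) 1 := ⟨by positivity, min_le_right _ _⟩
  obtain ⟨N2, h2⟩ := hdist _ hε'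
  refine ⟨max N1 N2, fun n hn => ?_⟩
  have g1 := h1 n (le_of_max_le_left hn)
  obtain ⟨S, hS, e⟩ := hD n
  have hW := (hR n).measurable hA
  have g2 := sUnion_est μ (ν n) S (hν n) hS _ hW _ _ (h2 n (le_of_max_le_right hn))
  rw [← e] at g2
  have hx : min (ε / 4) 1 * μ.real (D n) * μ.real A ≤ ε / 4 := by
    have a1 : μ.real (D n) ≤ 1 := measureReal_le_one
    have a2 : μ.real A ≤ 1 := measureReal_le_one
    have a3 : min (ε / 4) 1 ≤ ε / 4 := min_le_left _ _
    have : μ.real (D n) * μ.real A ≤ 1 := mul_le_one₀ a1 measureReal_nonneg a2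
    rw [mul_assoc]
    nlinarith [hε'.1]
  rw [Real.dist_eq, sub_zero, abs_of_nonneg measureReal_nonneg] at g1
  have g3 : |μ.real B - μ.real (D n)| ≤ μ.real (symmDiff B (D n)) :=
    abs_measureReal_sub_le_measureReal_symmDiff hB.nullMeasurableSet (hDm n).nullMeasurableSet
  have g4 : |μ.real (B ∩ (R n) ⁻¹' A) - μ.real (D n ∩ (R n) ⁻¹' A)|
      ≤ μ.real (symmDiff B (D n)) := by
    refine (abs_measureReal_sub_le_measureReal_symmDiff (hB.inter hW).nullMeasurableSet
      ((hDm n).inter hW).nullMeasurableSet).trans (measureReal_mono ?_)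
    rw [← inter_symmDiff_distrib_right]
    exact inter_subset_left
  have g5 : |μ.real (D n) * μ.real A - μ.real A * μ.real B| ≤ μ.real (symmDiff B (D n)) := by
    have : μ.real (D n) * μ.real A - μ.real A * μ.real B
      = -(μ.real A * (μ.real B - μ.real (D n))) := by ring
    rw [this, abs_neg, abs_mul, abs_of_nonneg measureReal_nonneg]
    have a2 : μ.real A ≤ 1 := measureReal_le_one
    exact (mul_le_of_le_one_left (abs_nonneg _) a2).trans g3
  rw [Real.dist_eq]
  rw [abs_le] at g2 g4 g5
  rw [abs_lt]
  constructor <;> linarith [g2.1, g2.2, g4.1, g4.2, g5.1, g5.2]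

lemma dist_le_of_d3 (x y : T3) (r : ℝ) (h : d3 x y < r) : dist x y ≤ r := by
  have hne : {d : ℝ | ∃ a b : ℝ × ℝ × ℝ, pro3 a = x ∧ pro3 b = y ∧
    d = Real.sqrt ((a.1 - b.1) ^ 2 + (a.2.1 - b.2.1) ^ 2 + (a.2.2 - b.2.2) ^ 2)}.Nonempty :=
    ⟨_, (fc x.1, fc x.2.1, fc x.2.2), (fc y.1, fc y.2.1, fc y.2.2),
      by simp [pro3, coe_fc], by simp [pro3, coe_fc], rfl⟩
  obtain ⟨d, ⟨a, b, rfl, rfl, rfl⟩, hd⟩ := exists_lt_of_csInf_lt hne h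
  have key : ∀ u v : ℝ, dist (u : AddCircle (1 : ℝ)) (v : AddCircle (1 : ℝ)) ≤ |u - v| := by
    intro u v
    rw [dist_eq_norm, ← AddCircle.coe_sub]
    exact QuotientAddGroup.norm_mk_le_norm
  refine le_trans ?_ hd.le
  simp only [pro3, Prod.dist_eq]
  refine max_le ((key _ _).trans ?_) (max_le ((key _ _).trans ?_) ((key _ _).trans ?_)) <;>
  · apply Real.abs_le_sqrt
    nlinarith [sq_nonneg (a.1 - b.1), sq_nonneg (a.2.1 - b.2.1), sq_nonneg (a.2.2 - b.2.2)]

lemma d3_le (x y : T3) : d3 x y ≤ Real.sqrt 3 := by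
  unfold d3
  refine le_trans (csInf_le (a := Real.sqrt ((fc x.1 - fc y.1) ^ 2 + (fc x.2.1 - fc y.2.1) ^ 2
    + (fc x.2.2 - fc y.2.2) ^ 2)) ⟨0, ?_⟩ ⟨(fc x.1, fc x.2.1, fc x.2.2), (fc y.1, fc y.2.1, fc y.2.2),
      by simp [pro3, coe_fc], by simp [pro3, coe_fc], rfl⟩) ?_
  · rintro d ⟨a, b, -, -, rfl⟩
    exact Real.sqrt_nonneg _
  · apply Real.sqrt_le_sqrt
    have key : ∀ u v, (fc u - fc v) ^ 2 ≤ 1 := by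
      intro u v
      have := fc_mem u
      have := fc_mem v
      rw [sq_le_one_iff_abs_le_one, abs_le]
      constructor <;> linarith
    linarith [key x.1 y.1, key x.2.1 y.2.1, key x.2.2 y.2.2]

lemma memthick {α : Type*} [PseudoMetricSpace α] (x y : α) (r : ℝ) (A : Set α) (hy : y ∈ A)
    (h : dist x y ≤ r) : x ∈ Metric.cthickening r A :=
  Metric.mem_cthickening_of_dist_le x y r A hy h

lemma mixOn_closed (μ : Measure T3) [IsProbabilityMeasure μ] (R Q : ℕ → T3 → T3)
    (hQ : ∀ n, MeasurePreserving (Q n) μ μ)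
    (hmix : ∀ A, MeasurableSet A → MixOn μ R A) (δ : ℕ → ℝ) (hδ : Tendsto δ atTop (nhds 0))
    (hclose : ∀ n x, dist (R n x) (Q n x) ≤ δ n) (A : Set T3) (hA : IsClosed A) :
    MixOn μ Q A := by
  have up : ∀ B, MeasurableSet B → ∀ ε > 0,
      ∀ᶠ n in atTop, μ.real (B ∩ (Q n) ⁻¹' A) < μ.real A * μ.real B + ε := by
    intro B hB ε hε
    have ht : Tendsto (fun r => μ.real (Metric.cthickening r A)) (nhds 0) (nhds (μ.real A)) :=
      (ENNReal.tendsto_toReal (measure_ne_top _ _)).comp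
        (tendsto_measure_cthickening_of_isClosed ⟨1, one_pos, measure_ne_top _ _⟩ hA)
    have ht' := (tendsto_order.1 (ht.mono_left (nhdsWithin_le_nhds (s := Ioi 0)))).2
      (μ.real A + ε / 2) (by linarith)
    obtain ⟨r, hr, hr0⟩ := (ht'.and self_mem_nhdsWithin).exists
    have hr0 : 0 < r := hr0
    have hm := hmix (Metric.cthickening r A) Metric.isClosed_cthickening.measurableSet B hB
    have e1 := (tendsto_order.1 hm).2 (μ.real (Metric.cthickening r A) * μ.real B + ε / 2)
      (by linarith)
    have e2 := (tendsto_order.1 hδ).2 r hr0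
    filter_upwards [e1, e2] with n h1 h2
    have hsub : B ∩ (Q n) ⁻¹' A ⊆ B ∩ (R n) ⁻¹' (Metric.cthickening r A) := by
      rintro x ⟨hx, hx'⟩
      exact ⟨hx, memthick (R n x) (Q n x) r A hx' ((hclose n x).trans h2.le)⟩
    have h3 := measureReal_mono (μ := μ) hsub
    have h4 : μ.real B ≤ 1 := measureReal_le_one
    have h5 : 0 ≤ μ.real B := measureReal_nonneg
    nlinarith
  intro B hB
  rw [Metric.tendsto_nhds]
  intro ε hε
  filter_upwards [up B hB ε hε, up Bᶜ hB.compl ε hε] with n h1 h2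
  have e := measureReal_inter_add_sdiff (μ := μ) (s := (Q n) ⁻¹' A) hB
  rw [(hQ n).measureReal_preimage hA.measurableSet.nullMeasurableSet, sdiff_eq,
    inter_comm, inter_comm _ Bᶜ] at e
  rw [probReal_compl_eq_one_sub hB] at h2
  rw [Real.dist_eq, abs_lt]
  constructor <;> nlinarith

/-- criterion for weak mixing, Lemma 6.1–6.2 of Gunesch–Kunde in
dimension 3. If `T_n^{m_n}` uniformly approximates `T^{m_n}` and the partial
partitions `ν_n → ε` satisfy the asymptotic independence property on cubes, then `T`
is weakly mixing. -/
theorem statement14 (μ : Measure T3) [IsProbabilityMeasure μ]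
    (T : T3 → T3) (hTbij : Function.Bijective T) (hT : MeasurePreserving T μ μ)
    (m : ℕ → ℕ) (Tn : ℕ → T3 → T3)
    (hTnbij : ∀ n, Function.Bijective (Tn n)) (hTn : ∀ n, MeasurePreserving (Tn n) μ μ)
    (hclose : ∀ n, (⨆ x : T3, d3 ((Tn n)^[m n] x) (T^[m n] x)) < 1 / 2 ^ n)
    (ν : ℕ → Set (Set T3)) (hν : ∀ n, PartialPartition (ν n)) (hconv : ConvToPoints μ ν)
    (hdist : ∀ A : Set T3, IsCube3 A → ∀ ε : ℝ, ε ∈ Set.Ioc (0 : ℝ) 1 →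
      ∃ N : ℕ, ∀ n ≥ N, ∀ Γ ∈ ν n,
        |(μ (Γ ∩ ((Tn n)^[m n]) ⁻¹' A)).toReal - (μ Γ).toReal * (μ A).toReal|
          ≤ ε * (μ Γ).toReal * (μ A).toReal) :
    ∃ s : ℕ → ℕ, StrictMono s ∧ ∀ A B : Set T3, MeasurableSet A → MeasurableSet B →
      Tendsto (fun j => μ (B ∩ (T^[s j]) ⁻¹' A)) atTop (nhds (μ A * μ B)) := by
  have hbdd : ∀ n, BddAbove (range fun x : T3 => d3 ((Tn n)^[m n] x) (T^[m n] x)) := by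
    intro n
    refine ⟨Real.sqrt 3, ?_⟩
    rintro _ ⟨x, rfl⟩
    exact d3_le _ _
  have hR : ∀ n, MeasurePreserving ((Tn n)^[m n]) μ μ := fun n => (hTn n).iterate _
  have hQ : ∀ n, MeasurePreserving (T^[m n]) μ μ := fun n => hT.iterate _
  have hmixR : ∀ A, MeasurableSet A → MixOn μ (fun n => (Tn n)^[m n]) A := by
    refine mixOn_of_pi μ _ hR boxes boxes_gen boxes_pi ?_
    intro A hA
    rcases boxes_cases A hA with rfl | hc
    · intro B hB
      simp
    · exact mixOn_cube μ _ hR ν hν hconv A (boxes_meas A hA) (hdist A hc)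
  have hδ : Tendsto (fun n : ℕ => (1 : ℝ) / 2 ^ n) atTop (nhds 0) := by
    simpa using tendsto_pow_atTop_nhds_zero_of_lt_one (r := (1 / 2 : ℝ)) (by norm_num) (by norm_num)
  have hmix : ∀ A, MeasurableSet A → MixOn μ (fun n => T^[m n]) A := by
    refine mixOn_of_pi μ _ hQ {s | IsClosed s} ?_ isPiSystem_isClosed ?_
    · rw [← borel_eq_generateFrom_isClosed]
      exact BorelSpace.measurable_eq
    · intro A hA
      refine mixOn_closed μ _ _ hQ hmixR _ hδ (fun n x => ?_) A hA
      exact dist_le_of_d3 _ _ _ ((le_ciSup (hbdd n) x).trans_lt (hclose n))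
  have hfin : ∀ s : ℕ → ℕ, (∀ A B, MeasurableSet A → MeasurableSet B →
      Tendsto (fun j => μ.real (B ∩ (T^[s j]) ⁻¹' A)) atTop (nhds (μ.real A * μ.real B))) →
      ∀ A B : Set T3, MeasurableSet A → MeasurableSet B →
      Tendsto (fun j => μ (B ∩ (T^[s j]) ⁻¹' A)) atTop (nhds (μ A * μ B)) := by
    intro s h A B hA hB
    rw [← ENNReal.tendsto_toReal_iff (fun _ => measure_ne_top _ _)
      (ENNReal.mul_ne_top (measure_ne_top _ _) (measure_ne_top _ _)), ENNReal.toReal_mul]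
    exact h A B hA hB
  by_cases hk : ∀ k, ∀ᶠ n in atTop, m n ≠ k
  · have hm : Tendsto m atTop atTop := by
      rw [tendsto_atTop]
      intro b
      have : ∀ᶠ n in atTop, ∀ k ∈ Finset.range b, m n ≠ k :=
        (Finset.eventually_all _).2 fun k _ => hk k
      filter_upwards [this] with n hn
      by_contra hlt
      exact hn (m n) (Finset.mem_range.2 (not_le.1 hlt)) rfl
    obtain ⟨φ, hφ, hφ'⟩ := strictMono_subseq_of_tendsto_atTop hm
    exact ⟨m ∘ φ, hφ', hfin _ fun A B hA hB => (hmix A hA B hB).comp hφ.tendsto_atTop⟩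
  · push Not at hk
    obtain ⟨k, hk⟩ := hk
    obtain ⟨φ, hφ, hφk⟩ := extraction_of_frequently_atTop hk
    have hcst : ∀ A B, MeasurableSet A → MeasurableSet B →
        μ.real (B ∩ (T^[k]) ⁻¹' A) = μ.real A * μ.real B := by
      intro A B hA hB
      have h := (hmix A hA B hB).comp hφ.tendsto_atTop
      refine tendsto_nhds_unique (h.congr fun n => ?_) tendsto_const_nhds |>.symm
      simp [hφk n]
    have h01 : ∀ A, MeasurableSet A → μ.real A = 0 ∨ μ.real A = 1 := by
      intro A hA
      have hTk := hT.iterate k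
      have h := hcst A _ hA (hTk.measurable hA)
      rw [inter_self, hTk.measureReal_preimage hA.nullMeasurableSet] at h
      by_cases h0 : μ.real A = 0
      · exact Or.inl h0
      · right
        exact mul_left_cancel₀ h0 (by rw [← h, mul_one])
    refine ⟨id, strictMono_id, hfin _ fun A B hA hB => ?_⟩
    refine tendsto_const_nhds.congr fun j => ?_
    have hTj := hT.iterate j
    have hW := hTj.measurable hA
    have e := hTj.measureReal_preimage hA.nullMeasurableSet
    simp only [id]
    rcases h01 A hA with h | h
    · rw [h] at e ⊢
      rw [zero_mul]
      exact le_antisymm measureReal_nonneg ((measureReal_mono inter_subset_right).trans e.le)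
    · have h1 := measureReal_inter_add_sdiff (μ := μ) (s := B) hW
      have h2 : μ.real (B \ (T^[j]) ⁻¹' A) ≤ μ.real ((T^[j]) ⁻¹' A)ᶜ :=
        measureReal_mono (fun x hx => hx.2)
      rw [probReal_compl_eq_one_sub hW, e, h] at h2
      have h3 : 0 ≤ μ.real (B \ (T^[j]) ⁻¹' A) := measureReal_nonneg
      rw [h]
      linarith
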